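/- arXiv:2305.04892 — 4 statements merged into one kernel-verified Lean document; each statement's English description precedes it below -/
import Mathlib

section
/- Let G be a group acting on the circle S¹ by orientation-preserving homeomorphisms, and let g : S¹ → S¹ be pieced together from G. Assume the following expansivity property: for every integer p ≥ 1, the iterate g^p does not coincide with the identity map on any nonempty open arc of S¹. Then every point x ∈ S¹ whose forward g-orbit {g^n(x) : n ≥ 0} is a finite set is a fixed point of G, i.e. there exists T ∈ G with T·x = x such that T does not act as the identity map on S¹. -/
open Set Function

noncomputable section

/-- The circle `ℝ/ℤ`. -/
abbrev Circle1 : Type := AddCircle (1 : ℝ)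

/-- The left-closed right-open arc `[a, a + δ)` of the circle. -/
def arcIco (a : Circle1) (δ : ℝ) : Set Circle1 :=
  (fun t : ℝ => a + (t : Circle1)) '' Set.Ico 0 δ

/-- The open arc `(a, a + δ)` of the circle. -/
def arcIoo (a : Circle1) (δ : ℝ) : Set Circle1 :=
  (fun t : ℝ => a + (t : Circle1)) '' Set.Ioo 0 δ

/-- `G` acts on the circle by orientation-preserving homeomorphisms: every element acts
continuously (hence by a homeomorphism, its inverse being the action of the inverse) and maps
every sufficiently small arc `[y, y+δ)` onto an arc of the form `[T•y, T•y+δ')`. -/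
def ActsByOPHomeos (G : Type*) [Group G] [MulAction G Circle1] : Prop :=
  ∀ T : G, Continuous (fun x : Circle1 => T • x) ∧
    ∀ y : Circle1, ∃ δ₀ > (0 : ℝ), ∀ δ : ℝ, 0 < δ → δ ≤ δ₀ →
      ∃ δ' > (0 : ℝ), (fun x : Circle1 => T • x) '' arcIco y δ = arcIco (T • y) δ'

/-- `g` is pieced together from `G`: there is a finite partition of the circle into
left-closed right-open arcs on each of which `g` coincides with the action of a single
element of `G`. -/
def PiecedTogether (G : Type*) [Group G] [MulAction G Circle1]
    (g : Circle1 → Circle1) : Prop :=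
  ∃ (n : ℕ) (a : Fin n → Circle1) (δ : Fin n → ℝ) (T : Fin n → G),
    (∀ i, 0 < δ i) ∧
    (⋃ i, arcIco (a i) (δ i)) = Set.univ ∧
    (Pairwise fun i j => Disjoint (arcIco (a i) (δ i)) (arcIco (a j) (δ j))) ∧
    ∀ i, ∀ x ∈ arcIco (a i) (δ i), g x = T i • x

theorem arcIco_mono (a : Circle1) {δ ε : ℝ} (h : δ ≤ ε) : arcIco a δ ⊆ arcIco a ε :=
  Set.image_mono (Set.Ico_subset_Ico_right h)

theorem self_mem_arcIco (a : Circle1) {δ : ℝ} (h : 0 < δ) : a ∈ arcIco a δ :=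
  ⟨0, ⟨le_rfl, h⟩, by simp⟩

theorem local_iter {G : Type*} [Group G] [MulAction G Circle1] (g : Circle1 → Circle1)
    (hact : ActsByOPHomeos G) (hpieced : PiecedTogether G g) (n : ℕ) (y : Circle1) :
    ∃ S : G, ∃ δ > (0 : ℝ), ∀ w ∈ arcIco y δ, g^[n] w = S • w := by
  induction n with
  | zero => exact ⟨1, 1, one_pos, fun w _ => by simp⟩
  | succ n ih =>
    obtain ⟨S, δ, hδ, hS⟩ := ih
    obtain ⟨k, a, d, T, -, hcov, -, hT⟩ := hpieced
    have hy : S • y ∈ ⋃ i, arcIco (a i) (d i) := hcov ▸ Set.mem_univ _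
    obtain ⟨i, t, ⟨ht0, ht1⟩, ht⟩ := Set.mem_iUnion.1 hy
    have hsub : arcIco (S • y) (d i - t) ⊆ arcIco (a i) (d i) := by
      rintro _ ⟨s, ⟨hs0, hs1⟩, rfl⟩
      refine ⟨t + s, ⟨by linarith, by linarith⟩, ?_⟩
      simp only [← ht, AddCircle.coe_add, add_assoc]
    obtain ⟨δ₀, hδ₀, hinv⟩ := (hact S⁻¹).2 (S • y)
    obtain ⟨δ', hδ', himg⟩ := hinv (min δ₀ (d i - t)) (lt_min hδ₀ (by linarith))
      (min_le_left _ _)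
    rw [inv_smul_smul] at himg
    refine ⟨T i * S, min δ δ', lt_min hδ hδ', fun w hw => ?_⟩
    rw [Function.iterate_succ_apply', hS w (arcIco_mono _ (min_le_left _ _) hw), mul_smul]
    apply hT
    apply hsub
    have hw' := arcIco_mono _ (min_le_right _ _) hw
    rw [← himg] at hw'
    obtain ⟨v, hv, rfl⟩ := hw'
    simpa using arcIco_mono _ (min_le_right _ _) hv

/-- If `g` is pieced together from a group `G` acting on the circle by
orientation-preserving homeomorphisms, and no iterate `g^p` (`p ≥ 1`) coincides with the
identity on a nonempty open arc, then every point with finite forward `g`-orbit is a fixed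
point of `G`: it is fixed by some `T ∈ G` that does not act as the identity on the circle. -/
theorem stmt0 {G : Type*} [Group G] [MulAction G Circle1] (g : Circle1 → Circle1)
    (hact : ActsByOPHomeos G)
    (hpieced : PiecedTogether G g)
    (hexp : ∀ p : ℕ, 1 ≤ p →
      ¬ ∃ a : Circle1, ∃ δ > (0 : ℝ), ∀ x ∈ arcIoo a δ, g^[p] x = x)
    (x : Circle1) (hfin : (Set.range fun n : ℕ => g^[n] x).Finite) :
    ∃ T : G, T • x = x ∧ ¬ (∀ y : Circle1, T • y = y) := by
  obtain ⟨m, p, hp, hmp⟩ : ∃ m p : ℕ, 1 ≤ p ∧ g^[p] (g^[m] x) = g^[m] x := by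
    have hni : ¬ Function.Injective (fun n : ℕ => g^[n] x) := fun h =>
      Set.infinite_range_of_injective h hfin
    simp only [Function.Injective, not_forall] at hni
    obtain ⟨a, b, hab, hne⟩ := hni
    rcases lt_or_gt_of_ne hne with h | h
    · refine ⟨a, b - a, by omega, ?_⟩
      rw [← Function.iterate_add_apply, Nat.sub_add_cancel h.le]
      exact hab.symm
    · refine ⟨b, a - b, by omega, ?_⟩
      rw [← Function.iterate_add_apply, Nat.sub_add_cancel h.le]
      exact hab
  obtain ⟨S, δ, hδ, hS⟩ := local_iter g hact hpieced m x
  obtain ⟨R, ε, hε, hR⟩ := local_iter g hact hpieced p (g^[m] x)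
  have hSx := hS x (self_mem_arcIco x hδ)
  have hRz := hR _ (self_mem_arcIco _ hε)
  rw [hmp, hSx] at hRz
  refine ⟨S⁻¹ * R * S, ?_, fun hid => ?_⟩
  · rw [mul_smul, mul_smul, ← hRz, inv_smul_smul]
  · refine hexp p hp ⟨g^[m] x, ε, hε, fun w hw => ?_⟩
    rw [hR w (Set.image_mono Set.Ioo_subset_Ico_self hw)]
    have := hid (S⁻¹ • w)
    rw [mul_smul, mul_smul, smul_inv_smul] at this
    exact smul_left_cancel _ this
end
end

section
/- Let G be a group acting on a set X, let g : X → X be a function, and let γ : ℕ → X → G be an assignment satisfying g^p(x) = γ_p[x]·x for all x ∈ X and all integers p ≥ 0. Assume strong orbit equivalence holds: for every x ∈ X and every T ∈ G there exist integers p, q ≥ 0 such that γ_p[x] = γ_q[T·x]·T in G. Then every point x ∈ X fixed by some element T ∈ G with T ≠ 1 has finite forward g-orbit; more precisely, there exist integers p ≠ q with g^p(x) = g^q(x), so that the set {g^n(x) : n ≥ 0} is finite. -/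
open Set Function

/-- abstract Lemma 2.12. Let `G` act on a set `X`, let `g : X → X` and
`γ : ℕ → X → G` satisfy `g^p(x) = γ_p[x] • x` for all `p ≥ 0`.  If strong orbit equivalence
holds, then every point fixed by some `T ≠ 1` has finite forward `g`-orbit; more precisely,
`g^p(x) = g^q(x)` for some `p ≠ q`. -/
theorem stmt2 {X G : Type*} [Group G] [MulAction G X]
    (g : X → X) (γ : ℕ → X → G)
    (hγ : ∀ (p : ℕ) (x : X), g^[p] x = γ p x • x)
    (hsoe : ∀ (x : X) (T : G), ∃ p q : ℕ, γ p x = γ q (T • x) * T) :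
    ∀ (x : X) (T : G), T ≠ 1 → T • x = x →
      (∃ p q : ℕ, p ≠ q ∧ g^[p] x = g^[q] x) ∧
        (Set.range fun n : ℕ => g^[n] x).Finite := by
  intro x T hT hx
  obtain ⟨p, q, h⟩ := hsoe x T
  rw [hx] at h
  have hne : p ≠ q := by
    rintro rfl
    exact hT (by simpa using h)
  have heq : g^[p] x = g^[q] x := by
    rw [hγ, hγ, h, mul_smul, hx]
  refine ⟨⟨p, q, hne, heq⟩, ?_⟩
  have key : ∀ a b : ℕ, a < b → g^[a] x = g^[b] x →
      (Set.range fun n : ℕ => g^[n] x).Finite := by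
    intro a b hab hE
    refine ((Set.finite_lt_nat b).image fun n : ℕ => g^[n] x).subset ?_
    rintro _ ⟨n, rfl⟩
    induction n using Nat.strong_induction_on with
    | _ n ih =>
      by_cases hn : n < b
      · exact ⟨n, hn, rfl⟩
      · have h1 : g^[n] x = g^[n - b + a] x := by
          have h2 : n = n - b + b := by omega
          rw [Function.iterate_add_apply, hE, ← Function.iterate_add_apply, ← h2]
        have h3 := ih (n - b + a) (by omega)
        simp only [h1]
        exact h3
  rcases lt_or_gt_of_ne hne with hlt | hlt
  · exact key p q hlt heq
  · exact key q p hlt heq.symm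
end

section
/- Let n₁, n₂, n₃, n₄ be integers, each at least 2, with n₁ = n₃. Let σ be the permutation of {1,2,3,4} swapping 1 ↔ 2 and 3 ↔ 4, and define ρ(i) = σ(i) + 1, taken modulo 4 with representatives in {1,2,3,4} (so ρ is the transposition interchanging 1 and 3 and fixing 2 and 4). Define θ(i) = ρ^{n_i − 1}(i), and for a fixed i₀ ∈ {1,2,3,4} define the sequence (i_k)_{k ≥ 0} by i_{k+1} = θ(i_k) + 1, again taken modulo 4 with representatives in {1,2,3,4}. Then: (a) the sequence (i_k)_{k ≥ 0} is purely periodic; (b) its minimal period length is 2 if n₁ is even and 4 if n₁ is odd; and (c) consecutive terms of the sequence have opposite parity, i.e. i_{k+1} and i_k differ in parity for every k ≥ 0. -/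
open Set Function

/-- The permutation of `ℤ/4` (representatives `{1,2,3,4}`, with `4 ↔ 0`) swapping
`1 ↔ 2` and `3 ↔ 4`. -/
def sigma4 : ZMod 4 → ZMod 4 := fun i =>
  if i = 1 then 2 else if i = 2 then 1 else if i = 3 then 0 else 3

/-- `ρ(i) = σ(i) + 1` (mod 4); it is the transposition interchanging `1` and `3`. -/
def rho4 : ZMod 4 → ZMod 4 := fun i => sigma4 i + 1

/-- `θ(i) = ρ^{n_i - 1}(i)`. -/
def theta4 (n : ZMod 4 → ℕ) (i : ZMod 4) : ZMod 4 := rho4^[n i - 1] i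

/-- The index sequence `i_0 = i₀`, `i_{k+1} = θ(i_k) + 1` (mod 4). -/
def idxSeq (n : ZMod 4 → ℕ) (i₀ : ZMod 4) : ℕ → ZMod 4
  | 0 => i₀
  | k + 1 => theta4 n (idxSeq n i₀ k) + 1

theorem rho4_invol : Function.Involutive rho4 := by
  unfold Function.Involutive; decide

theorem theta4_even (n : ZMod 4 → ℕ) (hn : ∀ i, 2 ≤ n i) (h13 : n 1 = n 3)
    (h : Even (n 1)) (i : ZMod 4) : theta4 n i = rho4 i := by
  have fixed : ∀ j : ZMod 4, rho4 j = j → theta4 n j = rho4 j := fun j hj => by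
    rw [theta4, Function.iterate_fixed hj, hj]
  have odd : ∀ j : ZMod 4, Even (n j) → theta4 n j = rho4 j := fun j hj => by
    have h2 := hn j
    have : Odd (n j - 1) := by grind
    rw [theta4, rho4_invol.iterate_odd this]
  have cases : ∀ j : ZMod 4, rho4 j = j ∨ j = 1 ∨ j = 3 := by decide
  rcases cases i with hi | rfl | rfl
  · exact fixed _ hi
  · exact odd _ h
  · exact odd _ (h13 ▸ h)

theorem theta4_odd (n : ZMod 4 → ℕ) (h13 : n 1 = n 3)
    (h : ¬ Even (n 1)) (i : ZMod 4) : theta4 n i = i := by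
  have odd : ∀ j : ZMod 4, ¬ Even (n j) → theta4 n j = j := fun j hj => by
    have : Even (n j - 1) := by grind
    rw [theta4, rho4_invol.iterate_even this, id]
  have cases : ∀ j : ZMod 4, rho4 j = j ∨ j = 1 ∨ j = 3 := by decide
  rcases cases i with hi | rfl | rfl
  · rw [theta4, Function.iterate_fixed hi]
  · exact odd _ h
  · exact odd _ (h13 ▸ h)

/-- Lemma 4.5. Let `n₁, n₂, n₃, n₄ ≥ 2` with `n₁ = n₃`.  Then the index
sequence is purely periodic; its minimal period length is `2` if `n₁` is even and `4` if
`n₁` is odd; and consecutive terms have opposite parity. -/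
theorem stmt3 (n : ZMod 4 → ℕ) (hn : ∀ i, 2 ≤ n i) (h13 : n 1 = n 3) (i₀ : ZMod 4) :
    (∃ m : ℕ, 0 < m ∧ ∀ k : ℕ, idxSeq n i₀ (k + m) = idxSeq n i₀ k) ∧
    IsLeast {m : ℕ | 0 < m ∧ ∀ k : ℕ, idxSeq n i₀ (k + m) = idxSeq n i₀ k}
      (if Even (n 1) then 2 else 4) ∧
    (∀ k : ℕ, (idxSeq n i₀ (k + 1)).val % 2 ≠ (idxSeq n i₀ k).val % 2) := by
  have key : IsLeast {m : ℕ | 0 < m ∧ ∀ k : ℕ, idxSeq n i₀ (k + m) = idxSeq n i₀ k}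
      (if Even (n 1) then 2 else 4) ∧
      (∀ k : ℕ, (idxSeq n i₀ (k + 1)).val % 2 ≠ (idxSeq n i₀ k).val % 2) := by
    by_cases h : Even (n 1)
    · have step : ∀ k, idxSeq n i₀ (k + 1) = rho4 (idxSeq n i₀ k) + 1 := fun k => by
        rw [idxSeq, theta4_even n hn h13 h]
      have par : ∀ j : ZMod 4, (rho4 j + 1).val % 2 ≠ j.val % 2 := by decide
      have two : ∀ j : ZMod 4, rho4 (rho4 j + 1) + 1 = j := by decide
      have one : ∀ j : ZMod 4, rho4 j + 1 ≠ j := by decide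
      rw [if_pos h]
      refine ⟨⟨⟨by norm_num, fun k => ?_⟩, ?_⟩, fun k => ?_⟩
      · rw [step (k + 1), step k, two]
      · rintro m ⟨hm, hk⟩
        by_contra hlt
        obtain rfl : m = 1 := by omega
        have := hk 0
        rw [step 0] at this
        exact one _ this
      · rw [step k]; exact par _
    · have step : ∀ k, idxSeq n i₀ (k + 1) = idxSeq n i₀ k + 1 := fun k => by
        rw [idxSeq, theta4_odd n h13 h]
      have par : ∀ j : ZMod 4, (j + 1).val % 2 ≠ j.val % 2 := by decide
      have four : ∀ j : ZMod 4, j + 1 + 1 + 1 + 1 = j := by decide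
      have one : ∀ j : ZMod 4, j + 1 ≠ j ∧ j + 1 + 1 ≠ j ∧ j + 1 + 1 + 1 ≠ j := by decide
      rw [if_neg h]
      refine ⟨⟨⟨by norm_num, fun k => ?_⟩, ?_⟩, fun k => ?_⟩
      · rw [step (k + 3), step (k + 2), step (k + 1), step k, four]
      · rintro m ⟨hm, hk⟩
        by_contra hlt
        have hm3 : m = 1 ∨ m = 2 ∨ m = 3 := by omega
        have := hk 0
        rcases hm3 with rfl | rfl | rfl
        · rw [step 0] at this
          exact (one _).1 this
        · rw [step (0 + 1), step 0] at this
          exact (one _).2.1 this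
        · rw [step (0 + 2), step (0 + 1), step 0] at this
          exact (one _).2.2 this
      · rw [step k]; exact par _
  exact ⟨⟨_, key.1.1⟩, key⟩
end

section
/- Let S be a set, let f : S → S be a surjective function, let O ⊆ S be a subset on which f is injective, let D ⊆ O, and let f_α : S → S be a function that agrees with f on S ∖ D and satisfies f_α(D) ∩ f(D) = ∅ (where f_α(D) and f(D) denote images of D). Then f_α is surjective if and only if f(D) ⊆ f(S ∖ O). -/
open Set Function

/-- set-theoretic content of Lemma 5.1. Let `f : S → S` be surjective,
injective on a subset `O`, let `D ⊆ O`, and let `fα` agree with `f` off `D` and satisfy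
`fα(D) ∩ f(D) = ∅`.  Then `fα` is surjective iff `f(D) ⊆ f(S ∖ O)`. -/
theorem stmt4 {S : Type*} (f : S → S) (hf : Function.Surjective f)
    (O D : Set S) (hinj : Set.InjOn f O) (hDO : D ⊆ O)
    (fα : S → S) (hagree : ∀ x ∉ D, fα x = f x)
    (hdisj : (fα '' D) ∩ (f '' D) = ∅) :
    Function.Surjective fα ↔ f '' D ⊆ f '' Oᶜ := by
  constructor
  · rintro hs _ ⟨d, hd, rfl⟩
    obtain ⟨x, hx⟩ := hs (f d)
    have hxD : x ∉ D := by
      intro h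
      have hmem : f d ∈ (fα '' D) ∩ (f '' D) := ⟨⟨x, h, hx⟩, ⟨d, hd, rfl⟩⟩
      rw [hdisj] at hmem
      exact hmem
    have hfx : f x = f d := (hagree x hxD).symm.trans hx
    refine ⟨x, fun hxO => hxD ?_, hfx⟩
    rw [hinj hxO (hDO hd) hfx]
    exact hd
  · intro h y
    obtain ⟨x, rfl⟩ := hf y
    by_cases hx : x ∈ D
    · obtain ⟨z, hz, hzx⟩ := h ⟨x, hx, rfl⟩
      exact ⟨z, (hagree z fun hzD => hz (hDO hzD)).trans hzx⟩
    · exact ⟨x, hagree x hx⟩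
end
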